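/- arXiv:2308.01768 — 3 statements merged into one kernel-verified Lean document; each statement's English description precedes it below -/
import Mathlib

section
/- ⋆_c-SVD for 4-order tensors: for every A ∈ ℝ^{I1×I2×I3×I4} there exist U ∈ ℝ^{I1×I2×I3×I1}, S ∈ ℝ^{I1×I2×I3×I4}, V ∈ ℝ^{I4×I2×I3×I4} such that A = U ⋆_c (S ⋆_c Vᵀ), S[i1,i2,i3,i4] = 0 whenever i1 ≠ i4, and U and V are orthogonal with respect to the ⋆_c-product: for all i2 ∈ {1,…,I2} and i3 ∈ {1,…,I3}, the matrices Ū[:,i2,i3,:] and V̄[:,i2,i3,:] are orthogonal, where Ū and V̄ are obtained by applying C (of sizes I2 and I3) along modes 2 and 3 of U and V. -/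
open Matrix

/-- The discrete cosine transform matrix `C̄ ∈ ℝ^{n×n}` with (1-based) entries
`C̄[i,j] = √((2 − δ_{i,1})/n)·cos((i−1)(2j−1)π/(2n))`. -/
noncomputable def dctBar (n : ℕ) : Matrix (Fin n) (Fin n) ℝ :=
  fun i j => Real.sqrt ((2 - if i.val = 0 then 1 else 0) / n) *
    Real.cos ((i.val : ℝ) * (2 * (j.val : ℝ) + 1) * Real.pi / (2 * n))

/-- The vector `c₁ ∈ ℝ^n` with `c₁[i] = 1/C̄[i,1]`. -/
noncomputable def cOne (n : ℕ) (hn : 1 ≤ n) : Fin n → ℝ :=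
  fun i => 1 / dctBar n i ⟨0, hn⟩

/-- The matrix `C = diag(c₁)·C̄`. -/
noncomputable def Cmat (n : ℕ) (hn : 1 ≤ n) : Matrix (Fin n) (Fin n) ℝ :=
  Matrix.diagonal (cOne n hn) * dctBar n

/-- The unit upper bidiagonal matrix `Γ ∈ ℝ^{n×n}` with `Γ[i,i] = 1`,
`Γ[i,i+1] = 1` for `i < n`, and all other entries `0`. -/
def gammaMat (n : ℕ) : Matrix (Fin n) (Fin n) ℝ :=
  fun i j => if j.val = i.val then 1 else if j.val = i.val + 1 then 1 else 0

/-- The reflective extension `x̃ : ℤ → ℝ` of `x ∈ ℝ^n` (indices are 1-based):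
`x̃_j = x_j` for `1 ≤ j ≤ n`, `x̃_j = x_{1−j}` for `1−n ≤ j ≤ 0`,
`x̃_j = x_{2n+1−j}` for `n+1 ≤ j ≤ 2n`, and `0` outside this range. -/
noncomputable def reflGet {n : ℕ} (x : Fin n → ℝ) (j : ℤ) : ℝ :=
  if h : 1 ≤ j ∧ j ≤ (n : ℤ) then x ⟨(j - 1).toNat, by omega⟩
  else if h : 1 - (n : ℤ) ≤ j ∧ j ≤ 0 then x ⟨(-j).toNat, by omega⟩
  else if h : (n : ℤ) + 1 ≤ j ∧ j ≤ 2 * n then x ⟨(2 * n - j).toNat, by omega⟩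
  else 0

/-- Entry access with 0 outside bounds (used for the `|i−j|+1` indexing, which
always stays in range over the summation ranges below). -/
noncomputable def getN {I : ℕ} (v : Fin I → ℝ) (k : ℕ) : ℝ :=
  if h : k < I then v ⟨k, h⟩ else 0

/-- Applying matrices `M₂, M₃` along modes 2 and 3 of a 4-order tensor. -/
noncomputable def mode23 {I1 I2 I3 J : ℕ}
    (M2 : Matrix (Fin I2) (Fin I2) ℝ) (M3 : Matrix (Fin I3) (Fin I3) ℝ)
    (T : Fin I1 → Fin I2 → Fin I3 → Fin J → ℝ) :
    Fin I1 → Fin I2 → Fin I3 → Fin J → ℝ :=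
  fun i1 k2 k3 l => ∑ m2 : Fin I2, ∑ m3 : Fin I3, M2 k2 m2 * M3 k3 m3 * T i1 m2 m3 l

/-- The `⋆_c`-product of 4-order tensors (block convolution with reflective
boundary conditions in modes 2 and 3): with `Â` obtained by applying `Γ⁻¹`
along modes 2 and 3 of `A` and `X̃` the reflective extension of `X` in modes
2 and 3,
`Y[:,i2,i3,:] = Σ_{j2=i2−I2+1}^{i2+I2−1} Σ_{j3=i3−I3+1}^{i3+I3−1}
   Â[:,|i2−j2|+1,|i3−j3|+1,:]·X̃[:,j2,j3,:]`
(indices `i2, i3` are 1-based, realized as `i2.val+1`, `i3.val+1`). -/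
noncomputable def starc4 {I1 I2 I3 J I5 : ℕ}
    (A : Fin I1 → Fin I2 → Fin I3 → Fin J → ℝ)
    (X : Fin J → Fin I2 → Fin I3 → Fin I5 → ℝ) :
    Fin I1 → Fin I2 → Fin I3 → Fin I5 → ℝ :=
  fun i1 i2 i3 i5 =>
    ∑ j2 ∈ Finset.Icc (((i2.val : ℤ) + 1) - I2 + 1) (((i2.val : ℤ) + 1) + I2 - 1),
    ∑ j3 ∈ Finset.Icc (((i3.val : ℤ) + 1) - I3 + 1) (((i3.val : ℤ) + 1) + I3 - 1),
    ∑ l : Fin J,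
      getN (fun k2 => getN (fun k3 =>
            mode23 (gammaMat I2)⁻¹ (gammaMat I3)⁻¹ A i1 k2 k3 l)
          ((((i3.val : ℤ) + 1) - j3).natAbs)) ((((i2.val : ℤ) + 1) - j2).natAbs) *
      reflGet (fun k2 => reflGet (fun k3 => X l k2 k3 i5) j3) j2

/-- The transpose of a 4-order tensor with respect to `⋆_c`:
`Bᵀ[i1,i2,i3,i4] = B[i4,i2,i3,i1]`. -/
def ctransp4 {p I2 I3 q : ℕ} (B : Fin p → Fin I2 → Fin I3 → Fin q → ℝ) :
    Fin q → Fin I2 → Fin I3 → Fin p → ℝ :=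
  fun i1 i2 i3 i4 => B i4 i2 i3 i1

/-- A matrix whose columns form an orthonormal basis satisfies `Mᵀ * M = 1`. -/
lemma transpose_mul_of_orthonormalBasis {n : ℕ}
    (b : OrthonormalBasis (Fin n) ℝ (EuclideanSpace ℝ (Fin n))) :
    (Matrix.of fun i j => b j i)ᵀ * (Matrix.of fun i j => b j i) = 1 := by
  ext i j
  have h := b.inner_eq_ite i j
  rw [PiLp.inner_apply] at h
  simp only [Matrix.mul_apply, Matrix.transpose_apply, Matrix.of_apply, Matrix.one_apply]
  rw [← h]
  refine Finset.sum_congr rfl fun k _ => ?_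
  simp [mul_comm]

/-- The images under `T` of the eigenvectors of `T† ∘ T` are pairwise orthogonal, with the singular
values as norms. -/
lemma inner_map_eigenvectorBasis {E F : Type*} [NormedAddCommGroup E] [InnerProductSpace ℝ E]
    [FiniteDimensional ℝ E] [NormedAddCommGroup F] [InnerProductSpace ℝ F]
    [FiniteDimensional ℝ F] (T : E →ₗ[ℝ] F) {n : ℕ} (hn : Module.finrank ℝ E = n) (i j : Fin n) :
    inner ℝ (T (T.isSymmetric_adjoint_comp_self.eigenvectorBasis hn i))
      (T (T.isSymmetric_adjoint_comp_self.eigenvectorBasis hn j)) =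
      if i = j then T.singularValues j ^ 2 else 0 := by
  rw [← LinearMap.adjoint_inner_right, ← LinearMap.comp_apply,
    LinearMap.IsSymmetric.apply_eigenvectorBasis, inner_smul_right,
    OrthonormalBasis.inner_eq_ite, LinearMap.sq_singularValues_fin T hn]
  simp

/-- Full singular value decomposition of a real rectangular matrix. -/
theorem exists_svd {m n : ℕ} (A : Matrix (Fin m) (Fin n) ℝ) :
    ∃ (U : Matrix (Fin m) (Fin m) ℝ) (S : Matrix (Fin m) (Fin n) ℝ)
      (V : Matrix (Fin n) (Fin n) ℝ),
      A = U * (S * Vᵀ) ∧ (∀ i j, i.val ≠ j.val → S i j = 0) ∧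
      Uᵀ * U = 1 ∧ Vᵀ * V = 1 := by
  set T := Matrix.toEuclideanLin A with hTdef
  have hn : Module.finrank ℝ (EuclideanSpace ℝ (Fin n)) = n := by simp
  set b := T.isSymmetric_adjoint_comp_self.eigenvectorBasis hn with hb
  have hin : ∀ i j, inner ℝ (T (b i)) (T (b j)) = if i = j then T.singularValues j ^ 2 else 0 :=
    inner_map_eigenvectorBasis T hn
  have hzero : ∀ j : Fin n, T.singularValues j = 0 → T (b j) = 0 := by
    intro j hj
    have := hin j j
    rw [hj] at this
    simpa using this
  have hbig : ∀ k : ℕ, m ≤ k → T.singularValues k = 0 := by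
    intro k hk
    rw [T.singularValues_eq_zero_iff_le_finrank_range]
    exact (Submodule.finrank_le _).trans (by simpa using hk)
  let w : Fin m → EuclideanSpace ℝ (Fin m) := fun k =>
    if h : k.val < n then (T.singularValues k)⁻¹ • T (b ⟨k, h⟩) else 0
  let s : Set (Fin m) := {k | k.val < n ∧ T.singularValues k ≠ 0}
  have hw : Orthonormal ℝ (s.domRestrict w) := by
    rw [orthonormal_iff_ite]
    rintro ⟨i, hi, hi0⟩ ⟨j, hj, hj0⟩
    simp only [Set.domRestrict_apply, w, hi, hj, dite_true, inner_smul_left, inner_smul_right, hin,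
      Subtype.mk.injEq, Fin.ext_iff]
    split_ifs with h
    · simp only [h] at hi0 ⊢
      simp
      field_simp
    · simp
  obtain ⟨c, hc⟩ := hw.exists_orthonormalBasis_extension_of_card_eq (by simp)
  refine ⟨Matrix.of fun i j => c j i, Matrix.of fun i j => if i.val = j.val then
    T.singularValues j else 0, Matrix.of fun i j => b j i, ?_, ?_,
    transpose_mul_of_orthonormalBasis c, transpose_mul_of_orthonormalBasis b⟩
  · have hV := transpose_mul_of_orthonormalBasis b
    rw [← Matrix.mul_assoc]
    refine Eq.trans ?_ (congrArg (· * _) (?_ : A * (Matrix.of fun i j => b j i) = _))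
    · dsimp only
      rw [Matrix.mul_assoc, mul_eq_one_comm.mp hV, Matrix.mul_one]
    ext a j
    have h1 : (A * (Matrix.of fun i j => b j i)) a j = T (b j) a := by
      simp [hTdef, Matrix.mul_apply, Matrix.toLpLin_apply, Matrix.mulVec, dotProduct]
    rw [h1]
    simp only [Matrix.mul_apply, Matrix.of_apply, mul_ite, mul_zero]
    by_cases hj : j.val < m
    · rw [Finset.sum_eq_single ⟨j, hj⟩ (fun k _ hk => if_neg fun h => hk (Fin.ext h)) (by simp)]
      by_cases h0 : T.singularValues j = 0
      · simp [h0, hzero j h0]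
      · rw [hc ⟨j, hj⟩ ⟨j.2, h0⟩]
        simp [w]
        field_simp
    · rw [hzero j (hbig j (not_lt.mp hj))]
      symm
      simpa using Finset.sum_eq_zero fun (k : Fin m) _ => if_neg (by have := k.2; omega)
  · intro i j h
    simp [h]

/-- The unnormalized cosine mode `cos(k(2j+1)π/(2n))`, for an arbitrary integer `j`. -/
noncomputable def cosMode (n k : ℕ) (j : ℤ) : ℝ :=
  Real.cos ((k : ℝ) * (2 * (j : ℝ) + 1) * Real.pi / (2 * n))

lemma cosMode_neg (n k : ℕ) (j : ℤ) : cosMode n k (-1 - j) = cosMode n k j := by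
  unfold cosMode
  rw [← Real.cos_neg]
  congr 1
  push_cast
  ring

lemma cosMode_reflect {n : ℕ} (hn : 1 ≤ n) (k : ℕ) (j : ℤ) :
    cosMode n k (2 * n - 1 - j) = cosMode n k j := by
  unfold cosMode
  have hn' : (n : ℝ) ≠ 0 := by positivity
  rw [← Real.cos_nat_mul_two_pi_sub _ k]
  congr 1
  push_cast
  field_simp
  ring

lemma cosMode_add_add_cosMode_sub (n k : ℕ) (j p : ℤ) :
    cosMode n k (j + p) + cosMode n k (j - p) =
      2 * Real.cos (k * p * Real.pi / n) * cosMode n k j := by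
  unfold cosMode
  rw [Real.cos_add_cos, mul_right_comm]
  congr 1
  · congr 2
    push_cast
    ring
  · congr 1
    push_cast
    ring

lemma cosMode_zero_pos {n k : ℕ} (hk : k < n) : 0 < cosMode n k 0 := by
  unfold cosMode
  have hn : (0 : ℝ) < n := by exact_mod_cast (by omega : 0 < n)
  have hk' : (k : ℝ) < n := by exact_mod_cast hk
  have hpi := Real.pi_pos
  apply Real.cos_pos_of_mem_Ioo
  constructor
  · have : (0 : ℝ) ≤ k * (2 * ((0 : ℤ) : ℝ) + 1) * Real.pi / (2 * n) := by
      simp only [Int.cast_zero, mul_zero, zero_add, mul_one]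
      positivity
    linarith
  · rw [div_lt_div_iff₀ (by positivity) (by norm_num)]
    push_cast
    nlinarith

lemma Cmat_apply (n : ℕ) (hn : 1 ≤ n) (k j : Fin n) :
    Cmat n hn k j = cosMode n k (j.val : ℤ) / cosMode n k 0 := by
  have h0 := (cosMode_zero_pos k.2).ne'
  have hs : Real.sqrt ((2 - if k.val = 0 then 1 else 0) / n) ≠ 0 := by
    have : (0 : ℝ) < n := by exact_mod_cast hn
    apply (Real.sqrt_pos.mpr _).ne'
    split_ifs <;> norm_num <;> positivity
  have hd : ∀ j : Fin n, dctBar n k j = Real.sqrt ((2 - if k.val = 0 then 1 else 0) / n) *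
      cosMode n k (j.val : ℤ) := fun j => by simp [dctBar, cosMode]
  rw [Cmat, Matrix.diagonal_mul, cOne, hd, hd]
  simp only [Nat.cast_zero]
  field_simp

lemma sum_cos_odd_mul (θ : ℝ) (n : ℕ) :
    2 * Real.sin θ * ∑ j ∈ Finset.range n, Real.cos ((2 * j + 1) * θ) =
      Real.sin (2 * n * θ) := by
  induction n with
  | zero => simp
  | succ n ih =>
    rw [Finset.sum_range_succ, mul_add, ih,
      show 2 * ((n + 1 : ℕ) : ℝ) * θ = (2 * n + 1) * θ + θ by push_cast; ring,
      show 2 * (n : ℝ) * θ = (2 * n + 1) * θ - θ by ring, Real.sin_sub, Real.sin_add]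
    ring

lemma sum_cos_odd_eq_zero {n : ℕ} (m : ℤ) (hm : m ≠ 0) (hm' : |m| < 2 * n) :
    ∑ j ∈ Finset.range n, Real.cos ((2 * j + 1) * (m * Real.pi / (2 * n))) = 0 := by
  have hn : (n : ℝ) ≠ 0 := by
    rintro h
    have : n = 0 := by exact_mod_cast h
    subst this
    have := abs_nonneg m
    simp at hm'
    omega
  have h := sum_cos_odd_mul (m * Real.pi / (2 * n)) n
  rw [show 2 * (n : ℝ) * (m * Real.pi / (2 * n)) = m * Real.pi by field_simp,
    Real.sin_int_mul_pi] at h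
  refine (mul_eq_zero.mp h).resolve_left ?_
  refine mul_ne_zero two_ne_zero fun hs => ?_
  rw [Real.sin_eq_zero_iff] at hs
  obtain ⟨q, hq⟩ := hs
  have hq' : (q : ℝ) * (2 * n) = m := by
    have := Real.pi_ne_zero
    field_simp at hq
    linarith
  have hq'' : q * (2 * n) = m := by exact_mod_cast hq'
  rw [← hq'', abs_mul, abs_of_nonneg (by positivity : (0 : ℤ) ≤ 2 * n)] at hm'
  have hq0 : q ≠ 0 := by rintro rfl; simp at hq''; exact hm hq''.symm
  have := Int.one_le_abs hq0
  nlinarith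

lemma sum_cosMode_mul_cosMode {n : ℕ} (k l : Fin n) (hkl : k ≠ l) :
    ∑ j : Fin n, cosMode n k (j.val : ℤ) * cosMode n l (j.val : ℤ) = 0 := by
  have hne : k.val ≠ l.val := fun h => hkl (Fin.ext h)
  have hk := k.2
  have hl := l.2
  have h1 := sum_cos_odd_eq_zero (n := n) ((k.val : ℤ) - l.val) (by omega)
    (by rw [abs_lt]; omega)
  have h2 := sum_cos_odd_eq_zero (n := n) ((k.val : ℤ) + l.val) (by omega)
    (by rw [abs_lt]; omega)
  rw [Fin.sum_univ_eq_sum_range (fun j => cosMode n k (j : ℤ) * cosMode n l (j : ℤ)) n]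
  have h3 : ∀ j ∈ Finset.range n, cosMode n k (j : ℤ) * cosMode n l (j : ℤ) =
      (Real.cos ((2 * j + 1) * (((k.val : ℤ) - l.val : ℤ) * Real.pi / (2 * n))) +
        Real.cos ((2 * j + 1) * (((k.val : ℤ) + l.val : ℤ) * Real.pi / (2 * n)))) / 2 := by
    intro j _
    have h := Real.two_mul_cos_mul_cos ((k.val : ℝ) * (2 * (j : ℝ) + 1) * Real.pi / (2 * n))
      ((l.val : ℝ) * (2 * (j : ℝ) + 1) * Real.pi / (2 * n))
    simp only [cosMode, Int.cast_natCast]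
    rw [eq_div_iff two_ne_zero, mul_comm, ← mul_assoc, h]
    congr 2 <;> push_cast <;> ring
  rw [Finset.sum_congr rfl h3, ← Finset.sum_div, Finset.sum_add_distrib, h1, h2]
  simp

lemma Cmat_mul_transpose (n : ℕ) (hn : 1 ≤ n) :
    ∃ d : Fin n → ℝ, (∀ k, d k ≠ 0) ∧ Cmat n hn * (Cmat n hn)ᵀ = Matrix.diagonal d := by
  refine ⟨fun k => (Cmat n hn * (Cmat n hn)ᵀ) k k, fun k => ?_, ?_⟩
  · simp only [Matrix.mul_apply, Matrix.transpose_apply]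
    refine (Finset.sum_pos' (fun j _ => mul_self_nonneg _)
      ⟨⟨0, hn⟩, Finset.mem_univ _, ?_⟩).ne'
    simp [Cmat_apply, (cosMode_zero_pos k.2).ne']
  · ext k l
    rcases eq_or_ne k l with rfl | h
    · simp
    · rw [Matrix.diagonal_apply_ne _ h]
      simp only [Matrix.mul_apply, Matrix.transpose_apply, Cmat_apply, div_mul_div_comm]
      rw [← Finset.sum_div, sum_cosMode_mul_cosMode k l h, zero_div]

lemma isUnit_det_Cmat (n : ℕ) (hn : 1 ≤ n) : IsUnit (Cmat n hn).det := by
  obtain ⟨d, hd, h⟩ := Cmat_mul_transpose n hn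
  have h' := congrArg Matrix.det h
  rw [Matrix.det_mul, Matrix.det_diagonal] at h'
  refine isUnit_of_mul_isUnit_left (y := (Cmat n hn)ᵀ.det) ?_
  rw [h']
  exact (Finset.prod_ne_zero_iff.mpr fun k _ => hd k).isUnit

lemma isUnit_det_gammaMat (n : ℕ) : IsUnit (gammaMat n).det := by
  have h : (gammaMat n).BlockTriangular id := by
    intro i j hij
    simp only [id, Fin.lt_def] at hij
    simp only [gammaMat]
    rw [if_neg (by omega), if_neg (by omega)]
  rw [Matrix.det_of_isUpperTriangular h]
  simp [gammaMat]

/-- Coefficients of `getN`, viewed as a linear functional. -/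
def getCoeff {n : ℕ} (k : ℕ) (p : Fin n) : ℝ := if k = p.val then 1 else 0

/-- Coefficients of `reflGet`, viewed as a linear functional. -/
noncomputable def reflCoeff {n : ℕ} (j : ℤ) (q : Fin n) : ℝ := reflGet (Pi.single q 1) j

lemma getN_eq_sum {n : ℕ} (v : Fin n → ℝ) (k : ℕ) : getN v k = ∑ p, getCoeff k p * v p := by
  unfold getN getCoeff
  split_ifs with h
  · rw [Finset.sum_eq_single ⟨k, h⟩]
    · simp
    · intro b _ hb
      rw [if_neg fun e => hb (Fin.ext e.symm), zero_mul]
    · simp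
  · symm
    apply Finset.sum_eq_zero
    intro p _
    rw [if_neg (by have := p.2; omega), zero_mul]

lemma reflGet_eq_sum {n : ℕ} (x : Fin n → ℝ) (j : ℤ) :
    reflGet x j = ∑ q, reflCoeff j q * x q := by
  unfold reflCoeff reflGet
  split_ifs <;> simp [Pi.single_apply]

lemma reflGet_cosMode {n : ℕ} (hn : 1 ≤ n) (k : ℕ) {j : ℤ} (h1 : 1 - (n : ℤ) ≤ j)
    (h2 : j ≤ 2 * n) :
    reflGet (fun q : Fin n => cosMode n k (q.val : ℤ)) j = cosMode n k (j - 1) := by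
  unfold reflGet
  split_ifs with ha hb hc
  · refine congrArg (cosMode n k) ?_
    simp only
    omega
  · rw [← cosMode_neg n k (j - 1)]
    refine congrArg (cosMode n k) ?_
    simp only
    omega
  · rw [← cosMode_reflect hn k (j - 1)]
    refine congrArg (cosMode n k) ?_
    simp only
    omega
  · omega

/-- The kernel of the one-dimensional convolution with reflective boundary conditions. -/
noncomputable def convKernel {n : ℕ} (i p q : Fin n) : ℝ :=
  ∑ j ∈ Finset.Icc (((i.val : ℤ) + 1) - n + 1) (((i.val : ℤ) + 1) + n - 1),
    getCoeff ((((i.val : ℤ) + 1) - j).natAbs) p * reflCoeff j q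

/-- The eigenvalue of the reflective shift by `p` on the `k`-th cosine mode. -/
noncomputable def shiftEigenvalue (n k p : ℕ) : ℝ :=
  if p = 0 then 1 else 2 * Real.cos (k * p * Real.pi / n)

lemma sum_convKernel_cosMode {n : ℕ} (k : ℕ) (i p : Fin n) :
    ∑ q, convKernel i p q * cosMode n k (q.val : ℤ) =
      shiftEigenvalue n k p * cosMode n k (i.val : ℤ) := by
  have hi := i.2
  have hp := p.2
  have hn : 1 ≤ n := by omega
  simp only [convKernel, Finset.sum_mul]
  rw [Finset.sum_comm]
  simp only [mul_assoc, ← Finset.mul_sum]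
  have hstep : ∀ j ∈ Finset.Icc (((i.val : ℤ) + 1) - n + 1) (((i.val : ℤ) + 1) + n - 1),
      getCoeff ((((i.val : ℤ) + 1) - j).natAbs) p *
        ∑ q : Fin n, reflCoeff j q * cosMode n k (q.val : ℤ) =
      if j ∈ ({(i.val : ℤ) + 1 + p, (i.val : ℤ) + 1 - p} : Finset ℤ) then
        cosMode n k (j - 1) else 0 := by
    intro j hj
    rw [Finset.mem_Icc] at hj
    rw [← reflGet_eq_sum (fun q : Fin n => cosMode n k (q.val : ℤ)),
      reflGet_cosMode hn k (by omega) (by omega), getCoeff, ite_mul, one_mul, zero_mul]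
    refine if_congr ?_ rfl rfl
    simp only [Finset.mem_insert, Finset.mem_singleton]
    omega
  have hsub : ({(i.val : ℤ) + 1 + p, (i.val : ℤ) + 1 - p} : Finset ℤ) ⊆
      Finset.Icc (((i.val : ℤ) + 1) - n + 1) (((i.val : ℤ) + 1) + n - 1) := by
    intro j
    simp only [Finset.mem_insert, Finset.mem_singleton, Finset.mem_Icc]
    omega
  rw [Finset.sum_congr rfl hstep, ← Finset.sum_filter, Finset.filter_mem_eq_inter,
    Finset.inter_eq_right.mpr hsub]
  unfold shiftEigenvalue
  split_ifs with h0
  · simp [h0]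
  · rw [Finset.sum_pair (by omega)]
    have h := cosMode_add_add_cosMode_sub n k i p
    rw [Int.cast_natCast] at h
    rw [← h]
    congr 2 <;> ring

lemma Cmat_mul_gammaMat_apply (n : ℕ) (hn : 1 ≤ n) (k p : Fin n) :
    (Cmat n hn * gammaMat n) k p = shiftEigenvalue n k p := by
  have h0 := (cosMode_zero_pos k.2).ne'
  have hp := p.2
  simp only [Matrix.mul_apply, gammaMat, Cmat_apply, mul_ite, mul_one, mul_zero, shiftEigenvalue]
  split_ifs with hp0
  · rw [Finset.sum_eq_single p]
    · simp [hp0, h0]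
    · intro b _ hb
      rw [if_neg fun e => hb (Fin.ext e.symm), if_neg (by omega)]
    · simp
  · have hp1 : p.val - 1 < n := by omega
    have hne : p ≠ ⟨p.val - 1, hp1⟩ := by
      rw [Ne, Fin.ext_iff]
      simp only
      omega
    rw [Finset.sum_eq_add p ⟨p.val - 1, hp1⟩ hne]
    · rw [if_pos rfl, if_neg (by simp only; omega), if_pos (by simp only; omega), ← add_div,
        div_eq_iff h0]
      have h := cosMode_add_add_cosMode_sub n k 0 p
      rw [Int.cast_natCast] at h
      rw [← h, zero_add, ← cosMode_neg n k (0 - (p.val : ℤ))]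
      congr 2
      simp only
      omega
    · rintro c - ⟨hc, hc'⟩
      rw [Ne, Fin.ext_iff] at hc hc'
      simp only at hc'
      rw [if_neg (by omega), if_neg (by omega)]
    · simp
    · simp

/-- `C` turns the convolution with reflective boundary conditions into a pointwise product. -/
lemma sum_Cmat_mul_convKernel (n : ℕ) (hn : 1 ≤ n) (k p q : Fin n) :
    ∑ i, Cmat n hn k i * convKernel i p q =
      (Cmat n hn * gammaMat n) k p * Cmat n hn k q := by
  set C := Cmat n hn with hC
  let K : Matrix (Fin n) (Fin n) ℝ := Matrix.of fun i q => convKernel i p q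
  let L : Matrix (Fin n) (Fin n) ℝ := Matrix.diagonal fun l => (C * gammaMat n) l p
  obtain ⟨d, -, hd⟩ := Cmat_mul_transpose n hn
  have hK : K * Cᵀ = Cᵀ * L := by
    ext i l
    simp only [L, Matrix.mul_diagonal, Matrix.mul_apply (M := K), Matrix.transpose_apply, K,
      Matrix.of_apply]
    rw [hC, Cmat_mul_gammaMat_apply]
    simp only [Cmat_apply, ← mul_div_assoc, ← Finset.sum_div, sum_convKernel_cosMode]
    ring
  have hCK : C * K = L * C := by
    have hu : IsUnit Cᵀ := by
      rw [Matrix.isUnit_iff_isUnit_det, Matrix.det_transpose]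
      exact isUnit_det_Cmat n hn
    refine hu.mul_right_cancel ?_
    rw [Matrix.mul_assoc, hK, ← Matrix.mul_assoc, Matrix.mul_assoc L, hd, Matrix.diagonal_mul_diagonal,
      Matrix.diagonal_mul_diagonal]
    simp only [mul_comm]
  have := congrFun (congrFun hCK k) q
  simpa [L, K, Matrix.mul_apply (M := C) (N := Matrix.of _), Matrix.diagonal_mul] using this

lemma mode23_mode23 {I1 I2 I3 J : ℕ} (M2 N2 : Matrix (Fin I2) (Fin I2) ℝ)
    (M3 N3 : Matrix (Fin I3) (Fin I3) ℝ) (T : Fin I1 → Fin I2 → Fin I3 → Fin J → ℝ) :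
    mode23 M2 M3 (mode23 N2 N3 T) = mode23 (M2 * N2) (M3 * N3) T := by
  ext a k2 k3 b
  simp only [mode23, Matrix.mul_apply, Finset.mul_sum, Finset.sum_mul, ← Fintype.sum_prod_type']
  refine Fintype.sum_equiv ⟨fun x => (x.2.2.1, x.2.2.2, x.2.1, x.1),
    fun x => (x.2.2.2, x.2.2.1, x.1, x.2.1), fun _ => rfl, fun _ => rfl⟩ _ _ fun _ => ?_
  simp only [Equiv.coe_fn_mk]
  ring

lemma mode23_one {I1 I2 I3 J : ℕ} (T : Fin I1 → Fin I2 → Fin I3 → Fin J → ℝ) :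
    mode23 1 1 T = T := by
  ext a k2 k3 b
  simp [mode23, Matrix.one_apply]

lemma mode23_inv {I1 I2 I3 J : ℕ} {M2 : Matrix (Fin I2) (Fin I2) ℝ}
    {M3 : Matrix (Fin I3) (Fin I3) ℝ} (h2 : IsUnit M2.det) (h3 : IsUnit M3.det)
    (T : Fin I1 → Fin I2 → Fin I3 → Fin J → ℝ) :
    mode23 M2 M3 (mode23 M2⁻¹ M3⁻¹ T) = T := by
  rw [mode23_mode23, Matrix.mul_nonsing_inv _ h2, Matrix.mul_nonsing_inv _ h3, mode23_one]

lemma mode23_injective {I1 I2 I3 J : ℕ} {M2 : Matrix (Fin I2) (Fin I2) ℝ}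
    {M3 : Matrix (Fin I3) (Fin I3) ℝ} (h2 : IsUnit M2.det) (h3 : IsUnit M3.det) :
    Function.Injective (mode23 (I1 := I1) (J := J) M2 M3) := by
  refine Function.LeftInverse.injective (g := mode23 M2⁻¹ M3⁻¹) fun T => ?_
  rw [mode23_mode23, Matrix.nonsing_inv_mul _ h2, Matrix.nonsing_inv_mul _ h3, mode23_one]

lemma starc4_eq_sum_convKernel {I1 I2 I3 J I5 : ℕ} (A : Fin I1 → Fin I2 → Fin I3 → Fin J → ℝ)
    (X : Fin J → Fin I2 → Fin I3 → Fin I5 → ℝ) (a : Fin I1) (i2 : Fin I2) (i3 : Fin I3)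
    (b : Fin I5) :
    starc4 A X a i2 i3 b = ∑ l, ∑ p2, ∑ p3, ∑ q2, ∑ q3, convKernel i2 p2 q2 *
      convKernel i3 p3 q3 * mode23 (gammaMat I2)⁻¹ (gammaMat I3)⁻¹ A a p2 p3 l *
        X l q2 q3 b := by
  simp only [starc4, getN_eq_sum, reflGet_eq_sum, convKernel]
  generalize mode23 (gammaMat I2)⁻¹ (gammaMat I3)⁻¹ A = B
  simp only [← Finset.sum_coe_sort (Finset.Icc _ _), Finset.mul_sum, Finset.sum_mul]
  simp only [← Fintype.sum_prod_type']
  refine Fintype.sum_equiv ⟨fun (j2, j3, l, q2, q3, p2, p3) => (l, p2, p3, q2, q3, j3, j2),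
    fun (l, p2, p3, q2, q3, j3, j2) => (j2, j3, l, q2, q3, p2, p3), fun _ => rfl, fun _ => rfl⟩ _ _ fun _ => ?_
  simp only [Equiv.coe_fn_mk]
  ring

/-- `C` applied along modes 2 and 3 turns the `⋆_c`-product into the slicewise matrix product. -/
theorem mode23_Cmat_starc4 {I1 I2 I3 J I5 : ℕ} (h2 : 1 ≤ I2) (h3 : 1 ≤ I3)
    (A : Fin I1 → Fin I2 → Fin I3 → Fin J → ℝ) (X : Fin J → Fin I2 → Fin I3 → Fin I5 → ℝ)
    (a : Fin I1) (k2 : Fin I2) (k3 : Fin I3) (b : Fin I5) :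
    mode23 (Cmat I2 h2) (Cmat I3 h3) (starc4 A X) a k2 k3 b =
      ∑ l, mode23 (Cmat I2 h2) (Cmat I3 h3) A a k2 k3 l *
        mode23 (Cmat I2 h2) (Cmat I3 h3) X l k2 k3 b := by
  have hA := mode23_inv (isUnit_det_gammaMat I2) (isUnit_det_gammaMat I3) A
  set B := mode23 (gammaMat I2)⁻¹ (gammaMat I3)⁻¹ A with hB
  have hCA : mode23 (Cmat I2 h2) (Cmat I3 h3) A =
      mode23 (Cmat I2 h2 * gammaMat I2) (Cmat I3 h3 * gammaMat I3) B := by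
    rw [← mode23_mode23, hA]
  rw [hCA]
  have key : ∀ l, ∀ p2 p3 q2 q3,
      ∑ i2, ∑ i3, Cmat I2 h2 k2 i2 * Cmat I3 h3 k3 i3 * (convKernel i2 p2 q2 *
        convKernel i3 p3 q3 * B a p2 p3 l * X l q2 q3 b) =
      ((Cmat I2 h2 * gammaMat I2) k2 p2 * (Cmat I3 h3 * gammaMat I3) k3 p3 * B a p2 p3 l) *
        (Cmat I2 h2 k2 q2 * Cmat I3 h3 k3 q3 * X l q2 q3 b) := by
    intro l p2 p3 q2 q3
    calc _ = (∑ i2, Cmat I2 h2 k2 i2 * convKernel i2 p2 q2) *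
          (∑ i3, Cmat I3 h3 k3 i3 * convKernel i3 p3 q3) * (B a p2 p3 l * X l q2 q3 b) := by
          rw [Finset.sum_mul_sum, Finset.sum_mul]
          refine Finset.sum_congr rfl fun _ _ => ?_
          rw [Finset.sum_mul]
          refine Finset.sum_congr rfl fun _ _ => ?_
          ring
      _ = _ := by
          rw [sum_Cmat_mul_convKernel, sum_Cmat_mul_convKernel]
          ring
  calc _ = ∑ l, ∑ p2, ∑ p3, ∑ q2, ∑ q3, ∑ i2, ∑ i3, Cmat I2 h2 k2 i2 * Cmat I3 h3 k3 i3 *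
        (convKernel i2 p2 q2 * convKernel i3 p3 q3 * B a p2 p3 l * X l q2 q3 b) := by
        simp only [mode23.eq_1 (Cmat I2 h2), starc4_eq_sum_convKernel, ← hB, Finset.mul_sum]
        simp only [← Fintype.sum_prod_type']
        refine Fintype.sum_equiv ⟨fun (i2, i3, l, p2, p3, q2, q3) => (l, p2, p3, q2, q3, i2, i3),
          fun (l, p2, p3, q2, q3, i2, i3) => (i2, i3, l, p2, p3, q2, q3), fun _ => rfl, fun _ => rfl⟩ _ _ fun _ => ?_
        simp only [Equiv.coe_fn_mk]
    _ = _ := by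
        simp only [key]
        simp only [mode23, Finset.mul_sum, Finset.sum_mul]
        simp only [← Fintype.sum_prod_type']
        refine Fintype.sum_equiv ⟨fun (l, p2, p3, q2, q3) => (l, q2, q3, p2, p3),
          fun (l, q2, q3, p2, p3) => (l, p2, p3, q2, q3), fun _ => rfl, fun _ => rfl⟩ _ _ fun _ => ?_
        simp only [Equiv.coe_fn_mk]

/-- `⋆_c`-SVD for 4-order tensors: every `A ∈ ℝ^{I1×I2×I3×I4}` factors as
`A = U ⋆_c (S ⋆_c Vᵀ)` with `S` f-diagonal and `U, V` orthogonal with respect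
to the `⋆_c`-product: for all `i2, i3`, the slices `Ū[:,i2,i3,:]` and
`V̄[:,i2,i3,:]` are orthogonal matrices, where `Ū, V̄` apply `C` along
modes 2 and 3 of `U, V`. -/
theorem starcSVD4 (I1 I2 I3 I4 : ℕ) (h2 : 1 ≤ I2) (h3 : 1 ≤ I3)
    (A : Fin I1 → Fin I2 → Fin I3 → Fin I4 → ℝ) :
    ∃ (U : Fin I1 → Fin I2 → Fin I3 → Fin I1 → ℝ)
      (S : Fin I1 → Fin I2 → Fin I3 → Fin I4 → ℝ)
      (V : Fin I4 → Fin I2 → Fin I3 → Fin I4 → ℝ),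
      A = starc4 U (starc4 S (ctransp4 V)) ∧
      (∀ (i1 : Fin I1) (i2 : Fin I2) (i3 : Fin I3) (i4 : Fin I4),
        i1.val ≠ i4.val → S i1 i2 i3 i4 = 0) ∧
      (∀ (i2 : Fin I2) (i3 : Fin I3),
        (Matrix.of fun a b : Fin I1 => mode23 (Cmat I2 h2) (Cmat I3 h3) U a i2 i3 b) *
            (Matrix.of fun a b : Fin I1 => mode23 (Cmat I2 h2) (Cmat I3 h3) U a i2 i3 b)ᵀ = 1 ∧
        (Matrix.of fun a b : Fin I1 => mode23 (Cmat I2 h2) (Cmat I3 h3) U a i2 i3 b)ᵀ *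
            (Matrix.of fun a b : Fin I1 => mode23 (Cmat I2 h2) (Cmat I3 h3) U a i2 i3 b) = 1) ∧
      (∀ (i2 : Fin I2) (i3 : Fin I3),
        (Matrix.of fun a b : Fin I4 => mode23 (Cmat I2 h2) (Cmat I3 h3) V a i2 i3 b) *
            (Matrix.of fun a b : Fin I4 => mode23 (Cmat I2 h2) (Cmat I3 h3) V a i2 i3 b)ᵀ = 1 ∧
        (Matrix.of fun a b : Fin I4 => mode23 (Cmat I2 h2) (Cmat I3 h3) V a i2 i3 b)ᵀ *
            (Matrix.of fun a b : Fin I4 => mode23 (Cmat I2 h2) (Cmat I3 h3) V a i2 i3 b) = 1) := by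
  have hC2 := isUnit_det_Cmat I2 h2
  have hC3 := isUnit_det_Cmat I3 h3
  choose U S V hA hS hU hV using fun (i2 : Fin I2) (i3 : Fin I3) =>
    exists_svd (Matrix.of fun a b => mode23 (Cmat I2 h2) (Cmat I3 h3) A a i2 i3 b)
  refine ⟨mode23 (Cmat I2 h2)⁻¹ (Cmat I3 h3)⁻¹ fun a i2 i3 b => U i2 i3 a b,
    mode23 (Cmat I2 h2)⁻¹ (Cmat I3 h3)⁻¹ fun a i2 i3 b => S i2 i3 a b,
    mode23 (Cmat I2 h2)⁻¹ (Cmat I3 h3)⁻¹ fun a i2 i3 b => V i2 i3 a b, ?_, ?_, ?_, ?_⟩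
  · apply mode23_injective hC2 hC3
    ext a i2 i3 b
    have htransp : ctransp4 (mode23 (Cmat I2 h2)⁻¹ (Cmat I3 h3)⁻¹ fun a i2 i3 b => V i2 i3 a b) =
      mode23 (Cmat I2 h2)⁻¹ (Cmat I3 h3)⁻¹ fun a i2 i3 b => V i2 i3 b a := rfl
    simp only [mode23_Cmat_starc4, htransp, mode23_inv hC2 hC3]
    exact congrFun (congrFun (hA i2 i3) a) b
  · intro a i2 i3 b hab
    simp [mode23, hS _ _ a b hab]
  · intro i2 i3
    rw [mode23_inv hC2 hC3]
    exact ⟨mul_eq_one_comm.mp (hU i2 i3), hU i2 i3⟩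
  · intro i2 i3
    rw [mode23_inv hC2 hC3]
    exact ⟨mul_eq_one_comm.mp (hV i2 i3), hV i2 i3⟩
end

section
/- The tensor transpose is the adjoint of the ⋆_c-product: for all A ∈ ℝ^{n1×n2×ℓ}, X ∈ ℝ^{ℓ×n2×n3}, and Y ∈ ℝ^{n1×n2×n3}, ⟨A ⋆_c X, Y⟩ = ⟨X, Aᵀ ⋆_c Y⟩, where ⟨·,·⟩ is the Frobenius (entrywise sum-of-products) inner product of tensors. -/
open Matrix

/-- The Toeplitz-plus-Hankel matrix `Th(a) ∈ ℝ^{n×n}` (1-based formula):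
`Th(a)[i,j] = a[|i−j|+1] + (1 − δ_{i+j,n+1})·b_{ij}`, where `b_{ij} = a[i+j]`
if `i+j ≤ n` and `b_{ij} = a[2(n+1)−(i+j)]` if `i+j > n`.
Indices `i j : Fin n` correspond to 1-based indices `i.val+1`, `j.val+1`. -/
noncomputable def thMat {n : ℕ} (a : Fin n → ℝ) : Matrix (Fin n) (Fin n) ℝ :=
  fun i j =>
    a ⟨i.val - j.val + (j.val - i.val), by have := i.isLt; have := j.isLt; omega⟩ +
    if hd : i.val + j.val + 1 = n then 0
    else if hle : i.val + j.val + 2 ≤ n then a ⟨i.val + j.val + 1, by omega⟩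
    else a ⟨2 * n - 1 - (i.val + j.val), by have := i.isLt; have := j.isLt; omega⟩

/-- The `⋆_c`-product of 3-order tensors: with `Â = (Γ⁻¹)₂.A`, the mode-2 block
convolution with reflective boundary conditions
`Y[:,i,:] = Σ_j ( Â[:,|i−j|+1,:] + (1 − δ_{i+j,n2+1})·B_{ij} )·X[:,j,:]`,
whose mode-2 kernel is exactly `Th` applied to the mode-2 fibers of `Â`. -/
noncomputable def starc3 {n1 n2 l n3 : ℕ}
    (A : Fin n1 → Fin n2 → Fin l → ℝ) (X : Fin l → Fin n2 → Fin n3 → ℝ) :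
    Fin n1 → Fin n2 → Fin n3 → ℝ :=
  fun i1 i i3 => ∑ m : Fin l, ∑ j : Fin n2,
    thMat ((gammaMat n2)⁻¹ *ᵥ fun k => A i1 k m) i j * X m j i3

/-- The transpose of a 3-order tensor: `Bᵀ[i1,i2,i3] = B[i3,i2,i1]`. -/
def ctransp3 {p n2 q : ℕ} (B : Fin p → Fin n2 → Fin q → ℝ) :
    Fin q → Fin n2 → Fin p → ℝ :=
  fun i1 i2 i3 => B i3 i2 i1

theorem thMat_symm {n : ℕ} (a : Fin n → ℝ) (i j : Fin n) : thMat a i j = thMat a j i := by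
  simp only [thMat, Nat.add_comm (i.val - j.val), Nat.add_comm i.val j.val]

/-- The tensor transpose is the adjoint of the `⋆_c`-product: for all
`A ∈ ℝ^{n1×n2×ℓ}`, `X ∈ ℝ^{ℓ×n2×n3}`, `Y ∈ ℝ^{n1×n2×n3}`,
`⟨A ⋆_c X, Y⟩ = ⟨X, Aᵀ ⋆_c Y⟩` in the Frobenius inner product. -/
theorem starc3_adjoint (n1 n2 l n3 : ℕ)
    (A : Fin n1 → Fin n2 → Fin l → ℝ) (X : Fin l → Fin n2 → Fin n3 → ℝ)
    (Y : Fin n1 → Fin n2 → Fin n3 → ℝ) :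
    ∑ i1 : Fin n1, ∑ i2 : Fin n2, ∑ i3 : Fin n3, starc3 A X i1 i2 i3 * Y i1 i2 i3 =
      ∑ m : Fin l, ∑ i2 : Fin n2, ∑ i3 : Fin n3,
        X m i2 i3 * starc3 (ctransp3 A) Y m i2 i3 := by
  simp only [starc3, ctransp3, Finset.sum_mul, Finset.mul_sum]
  have reorder (f : Fin n1 → Fin n2 → Fin n3 → Fin l → Fin n2 → ℝ) :
      ∑ i1, ∑ i2, ∑ i3, ∑ m, ∑ j, f i1 i2 i3 m j =
        ∑ m, ∑ j, ∑ i3, ∑ i1, ∑ i2, f i1 i2 i3 m j := by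
    simp only [← Fintype.sum_prod_type']
    refine Fintype.sum_equiv
      ⟨fun p => (p.2.2.2.1, p.2.2.2.2, p.2.2.1, p.1, p.2.1),
        fun p => (p.2.2.2.1, p.2.2.2.2, p.2.2.1, p.1, p.2.1),
        fun _ => rfl, fun _ => rfl⟩ _ _ fun _ => rfl
  rw [reorder]
  refine Finset.sum_congr rfl fun m _ => Finset.sum_congr rfl fun j _ =>
    Finset.sum_congr rfl fun i3 _ => Finset.sum_congr rfl fun i1 _ =>
      Finset.sum_congr rfl fun i2 _ => ?_
  rw [thMat_symm _ i2 j]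
  ring
end

section
/- t-SVD for 4-order tensors: for every real tensor A ∈ ℝ^{n1×n2×n3×n4} with mode-2 indices in ZMod n2 and mode-3 indices in ZMod n3, there exist real tensors U ∈ ℝ^{n1×n2×n3×n1}, S ∈ ℝ^{n1×n2×n3×n4}, V ∈ ℝ^{n4×n2×n3×n4} such that A = U ⋆_t (S ⋆_t Vᵀ), S[i1,i2,i3,i4] = 0 whenever i1 ≠ i4, and U, V are ⋆_t-orthogonal: Uᵀ ⋆_t U = E_{n1} and Vᵀ ⋆_t V = E_{n4}. -/
open Matrix

/-- The t-product of 4-order real tensors (circular block convolution in modes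
2 and 3): `(A ⋆_t X)[i1,i2,i3,i4] = Σ_{j2,j3} Σ_l A[i1,i2−j2,i3−j3,l]·X[l,j2,j3,i4]`,
i.e. slice-wise `Y[:,i2,i3,:] = Σ_{j2,j3} A[:,i2−j2,i3−j3,:]·X[:,j2,j3,:]`. -/
noncomputable def tprod4 {p q r n2 n3 : ℕ} [NeZero n2] [NeZero n3]
    (A : Fin p → ZMod n2 → ZMod n3 → Fin q → ℝ)
    (X : Fin q → ZMod n2 → ZMod n3 → Fin r → ℝ) :
    Fin p → ZMod n2 → ZMod n3 → Fin r → ℝ :=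
  fun i1 i2 i3 i4 => ∑ j2 : ZMod n2, ∑ j3 : ZMod n3, ∑ l : Fin q,
    A i1 (i2 - j2) (i3 - j3) l * X l j2 j3 i4

/-- The t-transpose of a 4-order tensor: `Bᵀ[i1,i2,i3,i4] = B[i4,−i2,−i3,i1]`. -/
def ttransp4 {p q n2 n3 : ℕ} (B : Fin p → ZMod n2 → ZMod n3 → Fin q → ℝ) :
    Fin q → ZMod n2 → ZMod n3 → Fin p → ℝ :=
  fun i1 i2 i3 i4 => B i4 (-i2) (-i3) i1

/-- The identity tensor `E_m ∈ ℝ^{m×n2×n3×m}`: `E_m[i1,0,0,i4] = δ_{i1,i4}` and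
`E_m[:,i2,i3,:] = 0` whenever `(i2,i3) ≠ (0,0)`. -/
def tId4 (m n2 n3 : ℕ) : Fin m → ZMod n2 → ZMod n3 → Fin m → ℝ :=
  fun i1 i2 i3 i4 => if i2 = 0 ∧ i3 = 0 ∧ i1 = i4 then 1 else 0

open scoped InnerProductSpace

/-- **Singular value decomposition** of a linear map: orthonormal bases of the domain and the
codomain in which the map is diagonal. -/
theorem LinearMap.exists_orthonormalBasis_inner_apply_eq_zero {𝕜 E F : Type*} [RCLike 𝕜]
    [NormedAddCommGroup E] [InnerProductSpace 𝕜 E] [FiniteDimensional 𝕜 E]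
    [NormedAddCommGroup F] [InnerProductSpace 𝕜 F] [FiniteDimensional 𝕜 F] {m n : ℕ}
    (hE : Module.finrank 𝕜 E = n) (hF : Module.finrank 𝕜 F = m) (T : E →ₗ[𝕜] F) :
    ∃ (u : OrthonormalBasis (Fin m) 𝕜 F) (v : OrthonormalBasis (Fin n) 𝕜 E),
      ∀ i j, i.val ≠ j.val → ⟪u i, T (v j)⟫_𝕜 = 0 := by
  set v := T.isSymmetric_adjoint_comp_self.eigenvectorBasis hE with hv
  have hTv (i j : Fin n) :
      ⟪T (v i), T (v j)⟫_𝕜 = if i = j then ((T.singularValues j : 𝕜)) ^ 2 else 0 := by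
    have h1 : (T.adjoint ∘ₗ T) (v j) = ((T.singularValues j : 𝕜) ^ 2) • v j := by
      rw [hv, LinearMap.IsSymmetric.apply_eigenvectorBasis, ← T.sq_singularValues_fin hE]
      simp
    rw [← LinearMap.adjoint_inner_right, ← LinearMap.comp_apply, h1, inner_smul_right,
      orthonormal_iff_ite.mp v.orthonormal]
    simp
  have hrn : Module.finrank 𝕜 T.range ≤ n := hE ▸ T.finrank_range_le
  have hrm : Module.finrank 𝕜 T.range ≤ m := hF ▸ T.range.finrank_le
  let w : Fin m → F := fun i =>
    if h : i.val < n then ((T.singularValues i : 𝕜))⁻¹ • T (v ⟨i, h⟩) else 0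
  have hw : Orthonormal 𝕜 (({i | i.val < Module.finrank 𝕜 T.range} : Set (Fin m)).domRestrict w) := by
    rw [orthonormal_iff_ite]
    rintro ⟨i, hi⟩ ⟨j, hj⟩
    have hi' : i.val < n := lt_of_lt_of_le hi hrn
    have hj' : j.val < n := lt_of_lt_of_le hj hrn
    have hσ : (T.singularValues j : 𝕜) ≠ 0 := by
      exact_mod_cast (T.singularValues_pos_iff_lt_finrank_range.mpr hj).ne'
    simp only [Set.domRestrict_apply, w, hi', hj', dite_true, inner_smul_left, inner_smul_right, hTv,
      Subtype.mk.injEq, Fin.mk.injEq, Fin.val_inj]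
    split_ifs with h
    · subst h
      simp only [map_inv₀, RCLike.conj_ofReal]
      field_simp
    · simp
  obtain ⟨u, hu⟩ := hw.exists_orthonormalBasis_extension_of_card_eq (by simpa using hF)
  refine ⟨u, v, fun i j hij => ?_⟩
  by_cases hj : j.val < Module.finrank 𝕜 T.range
  · have hσ : (T.singularValues j : 𝕜) ≠ 0 := by
      exact_mod_cast (T.singularValues_pos_iff_lt_finrank_range.mpr hj).ne'
    have h1 := hu ⟨j, lt_of_lt_of_le hj hrm⟩ hj
    simp only [w, j.isLt, dite_true] at h1
    have h2 : T (v j) = (T.singularValues j : 𝕜) • u ⟨j, lt_of_lt_of_le hj hrm⟩ := by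
      rw [h1, smul_inv_smul₀ hσ]
    rw [h2, inner_smul_right, orthonormal_iff_ite.mp u.orthonormal,
      if_neg (fun h => hij (congrArg Fin.val h)), mul_zero]
  · have h0 : T.singularValues j = 0 :=
      T.singularValues_eq_zero_iff_le_finrank_range.mpr (not_lt.mp hj)
    have h1 : T (v j) = 0 := by
      rw [← inner_self_eq_zero (𝕜 := 𝕜), hTv]
      simp [h0]
    rw [h1, inner_zero_right]

/-- The triple `(U, S, V)` is a full singular value decomposition `M = U * S * Vᴴ`. -/
structure Matrix.IsSVD {𝕜 : Type*} [RCLike 𝕜] {m n : ℕ} (M : Matrix (Fin m) (Fin n) 𝕜)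
    (X : Matrix (Fin m) (Fin m) 𝕜 × Matrix (Fin m) (Fin n) 𝕜 × Matrix (Fin n) (Fin n) 𝕜) :
    Prop where
  eq_mul : M = X.1 * (X.2.1 * X.2.2ᴴ)
  apply_eq_zero : ∀ i j, i.val ≠ j.val → X.2.1 i j = 0
  left_unitary : X.1ᴴ * X.1 = 1
  right_unitary : X.2.2ᴴ * X.2.2 = 1

theorem Matrix.exists_isSVD {𝕜 : Type*} [RCLike 𝕜] {m n : ℕ} (M : Matrix (Fin m) (Fin n) 𝕜) :
    ∃ X, M.IsSVD X := by
  obtain ⟨u, v, huv⟩ := LinearMap.exists_orthonormalBasis_inner_apply_eq_zero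
    (E := EuclideanSpace 𝕜 (Fin n)) (F := EuclideanSpace 𝕜 (Fin m)) (m := m) (n := n)
    (by simp) (by simp) (Matrix.toEuclideanLin M)
  have hunit {k : ℕ} (b : OrthonormalBasis (Fin k) 𝕜 (EuclideanSpace 𝕜 (Fin k))) :
      (Matrix.of fun i j => b j i)ᴴ * (Matrix.of fun i j => b j i) = 1 := by
    ext i j
    rw [Matrix.one_apply, ← orthonormal_iff_ite.mp b.orthonormal i j]
    simp [Matrix.mul_apply, PiLp.inner_apply, mul_comm]
  set U : Matrix (Fin m) (Fin m) 𝕜 := Matrix.of fun i j => u j i with hU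
  set V : Matrix (Fin n) (Fin n) 𝕜 := Matrix.of fun i j => v j i with hV
  refine ⟨(U, Uᴴ * (M * V), V), ?_, fun i j hij => ?_, hunit u, hunit v⟩
  · have hU' : U * Uᴴ = 1 := mul_eq_one_comm.mp (hunit u)
    have hV' : V * Vᴴ = 1 := mul_eq_one_comm.mp (hunit v)
    simp only [Matrix.mul_assoc, hV', Matrix.mul_one]
    rw [← Matrix.mul_assoc, hU', Matrix.one_mul]
  · rw [← huv i j hij]
    simp [Matrix.mul_apply, PiLp.inner_apply, hU, hV, Matrix.toLpLin_apply, Matrix.mulVec,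
      dotProduct, mul_comm]

/-- Entrywise application of a star-preserving ring homomorphism preserves decompositions. -/
theorem Matrix.IsSVD.map {𝕜 𝕜' : Type*} [RCLike 𝕜] [RCLike 𝕜'] {m n : ℕ}
    {M : Matrix (Fin m) (Fin n) 𝕜}
    {X : Matrix (Fin m) (Fin m) 𝕜 × Matrix (Fin m) (Fin n) 𝕜 × Matrix (Fin n) (Fin n) 𝕜}
    (h : M.IsSVD X) (f : 𝕜 →+* 𝕜') (hf : ∀ x, f (star x) = star (f x)) :
    (M.map f).IsSVD (X.1.map f, X.2.1.map f, X.2.2.map f) where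
  eq_mul := by
    rw [← Matrix.conjTranspose_map f hf, ← Matrix.map_mul, ← Matrix.map_mul, ← h.eq_mul]
  apply_eq_zero i j hij := by simp [h.apply_eq_zero i j hij]
  left_unitary := by
    rw [← Matrix.conjTranspose_map f hf, ← Matrix.map_mul, h.left_unitary]
    simp
  right_unitary := by
    rw [← Matrix.conjTranspose_map f hf, ← Matrix.map_mul, h.right_unitary]
    simp

/-- A relation invariant under a pair of involutions that is total, and has invariant solutions
at fixed points, contains the graph of an equivariant function. -/
theorem Function.Involutive.exists_equivariant {α β : Type*} {σ : α → α} {τ : β → β}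
    (hσ : Function.Involutive σ) (hτ : Function.Involutive τ) {P : α → β → Prop}
    (hP : ∀ a b, P a b → P (σ a) (τ b)) (h : ∀ a, ∃ b, P a b)
    (hfix : ∀ a, σ a = a → ∃ b, P a b ∧ τ b = b) :
    ∃ f : α → β, ∀ a, P a (f a) ∧ f (σ a) = τ (f a) := by
  classical
  choose g hg using h
  choose k hk hk' using hfix
  let _ : LinearOrder α := linearOrderOfSTO WellOrderingRel
  refine ⟨fun a => if h : σ a = a then k a h else if a < σ a then g a else τ (g (σ a)),
    fun a => ?_⟩
  have hσa := hσ a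
  by_cases h : σ a = a
  · simp only [h, dite_true]
    exact ⟨hk a h, (hk' a h).symm⟩
  · have h' : a ≠ σ a := Ne.symm h
    simp only [hσa, h, h', dite_false]
    rcases lt_or_gt_of_ne h' with hlt | hlt
    · simp only [hlt, hlt.not_gt, if_true, if_false, and_true]
      exact hg a
    · simp only [hlt, hlt.not_gt, if_true, if_false]
      exact ⟨by simpa [hσa] using hP _ _ (hg (σ a)), (hτ _).symm⟩

section Fourier

variable {p q r n2 n3 : ℕ} [NeZero n2] [NeZero n3]

/-- The discrete Fourier transform of a tensor along modes 2 and 3. -/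
noncomputable def tdft4 (A : Fin p → ZMod n2 → ZMod n3 → Fin q → ℝ)
    (ψ : AddChar (ZMod n2 × ZMod n3) ℂ) : Matrix (Fin p) (Fin q) ℂ :=
  Matrix.of fun i j => ∑ g : ZMod n2 × ZMod n3, ψ g * A i g.1 g.2 j

/-- The real part of the inverse discrete Fourier transform along modes 2 and 3. -/
noncomputable def tidft4 (X : AddChar (ZMod n2 × ZMod n3) ℂ → Matrix (Fin p) (Fin q) ℂ) :
    Fin p → ZMod n2 → ZMod n3 → Fin q → ℝ :=
  fun i a b j => ((Fintype.card (ZMod n2 × ZMod n3) : ℂ)⁻¹ * ∑ ψ, ψ (-(a, b)) * X ψ i j).re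

theorem tdft4_injective : Function.Injective
    (tdft4 : (Fin p → ZMod n2 → ZMod n3 → Fin q → ℝ) → _) := by
  intro A B h
  have key (C : Fin p → ZMod n2 → ZMod n3 → Fin q → ℝ) (i a b j) :
      ∑ ψ : AddChar (ZMod n2 × ZMod n3) ℂ, ψ (-(a, b)) * tdft4 C ψ i j =
        Fintype.card (ZMod n2 × ZMod n3) * (C i a b j : ℂ) := by
    simp only [tdft4, Matrix.of_apply, Finset.mul_sum]
    rw [Finset.sum_comm]
    simp only [← mul_assoc, ← AddChar.map_add_eq_mul, ← Finset.sum_mul,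
      AddChar.sum_apply_eq_ite, neg_add_eq_zero]
    simp
  funext i a b j
  have h1 := key A i a b j
  rw [h, key B i a b j] at h1
  have h0 : (Fintype.card (ZMod n2 × ZMod n3) : ℂ) ≠ 0 := by
    exact_mod_cast Fintype.card_ne_zero
  exact_mod_cast (mul_left_cancel₀ h0 h1).symm

theorem tdft4_tidft4 {X : AddChar (ZMod n2 × ZMod n3) ℂ → Matrix (Fin p) (Fin q) ℂ}
    (hX : ∀ ψ, X ψ⁻¹ = (X ψ).map (starRingEnd ℂ)) : tdft4 (tidft4 X) = X := by
  have hre (i a b j) : (tidft4 X i a b j : ℂ) =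
      (Fintype.card (ZMod n2 × ZMod n3) : ℂ)⁻¹ * ∑ ψ, ψ (-(a, b)) * X ψ i j := by
    rw [tidft4, ← Complex.conj_eq_iff_re, map_mul, map_sum]
    congr 1
    · simp
    · rw [← Equiv.sum_comp (Equiv.inv _)]
      refine Finset.sum_congr rfl fun ψ _ => ?_
      simp [hX, ← AddChar.map_neg_eq_conj]
  have h0 : (Fintype.card (ZMod n2 × ZMod n3) : ℂ) ≠ 0 := by
    exact_mod_cast Fintype.card_ne_zero
  funext ψ
  ext i j
  simp only [tdft4, Matrix.of_apply, hre, Finset.mul_sum]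
  rw [Finset.sum_comm]
  have h1 (χ : AddChar (ZMod n2 × ZMod n3) ℂ) :
      ∑ g : ZMod n2 × ZMod n3, ψ g * χ (-g) =
        if ψ = χ then (Fintype.card (ZMod n2 × ZMod n3) : ℂ) else 0 := by
    have := AddChar.sum_eq_ite (ψ * χ⁻¹)
    simpa [AddChar.mul_apply, AddChar.inv_apply, ← AddChar.one_eq_zero, mul_inv_eq_one] using this
  have h2 (χ : AddChar (ZMod n2 × ZMod n3) ℂ) :
      ∑ g : ZMod n2 × ZMod n3,
        ψ g * ((Fintype.card (ZMod n2 × ZMod n3) : ℂ)⁻¹ * (χ (-(g.1, g.2)) * X χ i j)) =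
      if ψ = χ then X χ i j else 0 := by
    calc _ = (∑ g : ZMod n2 × ZMod n3, ψ g * χ (-g)) *
          ((Fintype.card (ZMod n2 × ZMod n3) : ℂ)⁻¹ * X χ i j) := by
          rw [Finset.sum_mul]
          exact Finset.sum_congr rfl fun g _ => by ring
      _ = _ := by
          rw [h1]
          split_ifs
          · rw [mul_inv_cancel_left₀ h0]
          · simp
  simp only [h2]
  simp

theorem tdft4_tprod4 (A : Fin p → ZMod n2 → ZMod n3 → Fin q → ℝ)
    (B : Fin q → ZMod n2 → ZMod n3 → Fin r → ℝ) (ψ : AddChar (ZMod n2 × ZMod n3) ℂ) :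
    tdft4 (tprod4 A B) ψ = tdft4 A ψ * tdft4 B ψ := by
  ext i j
  have h1 (g : ZMod n2 × ZMod n3) : tprod4 A B i g.1 g.2 j =
      ∑ h : ZMod n2 × ZMod n3, ∑ l, A i (g - h).1 (g - h).2 l * B l h.1 h.2 j := by
    rw [tprod4, Fintype.sum_prod_type]
    rfl
  simp only [tdft4, Matrix.of_apply, Matrix.mul_apply, h1, Complex.ofReal_sum,
    Complex.ofReal_mul, Finset.mul_sum, Finset.sum_mul]
  rw [Finset.sum_comm, Finset.sum_comm (s := (Finset.univ : Finset (Fin q)))]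
  refine Finset.sum_congr rfl fun h _ => ?_
  rw [Finset.sum_comm]
  refine Finset.sum_congr rfl fun l _ => ?_
  rw [← Equiv.sum_comp (Equiv.addRight h)]
  refine Finset.sum_congr rfl fun g _ => ?_
  simp only [Equiv.coe_addRight, add_sub_cancel_right, AddChar.map_add_eq_mul]
  ring

theorem tdft4_ttransp4 (B : Fin p → ZMod n2 → ZMod n3 → Fin q → ℝ)
    (ψ : AddChar (ZMod n2 × ZMod n3) ℂ) : tdft4 (ttransp4 B) ψ = (tdft4 B ψ)ᴴ := by
  ext i j
  simp only [tdft4, Matrix.of_apply, Matrix.conjTranspose_apply, star_sum, star_mul']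
  rw [← Equiv.sum_comp (Equiv.neg _)]
  refine Finset.sum_congr rfl fun g _ => ?_
  simp [ttransp4, AddChar.map_neg_eq_conj]

theorem tdft4_tId4 (m : ℕ) (ψ : AddChar (ZMod n2 × ZMod n3) ℂ) :
    tdft4 (tId4 m n2 n3) ψ = 1 := by
  ext i j
  simp only [tdft4, Matrix.of_apply]
  rw [Finset.sum_eq_single 0]
  · simp [tId4, Matrix.one_apply, apply_ite Complex.ofReal]
  · rintro ⟨a, b⟩ _ hg
    have : ¬(a = 0 ∧ b = 0) := by simpa using hg
    have h2 : ¬(a = 0 ∧ b = 0 ∧ i = j) := fun h => this ⟨h.1, h.2.1⟩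
    simp [tId4, h2]
  · simp

theorem tdft4_inv (A : Fin p → ZMod n2 → ZMod n3 → Fin q → ℝ)
    (ψ : AddChar (ZMod n2 × ZMod n3) ℂ) : tdft4 A ψ⁻¹ = (tdft4 A ψ).map (starRingEnd ℂ) := by
  ext i j
  simp [tdft4, ← AddChar.map_neg_eq_conj]

end Fourier

/-- t-SVD for 4-order tensors: every real `A ∈ ℝ^{n1×n2×n3×n4}` factors as
`A = U ⋆_t (S ⋆_t Vᵀ)` with `S` f-diagonal and `U, V` ⋆_t-orthogonal. -/
theorem tSVD4 (n1 n2 n3 n4 : ℕ) [NeZero n2] [NeZero n3]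
    (A : Fin n1 → ZMod n2 → ZMod n3 → Fin n4 → ℝ) :
    ∃ (U : Fin n1 → ZMod n2 → ZMod n3 → Fin n1 → ℝ)
      (S : Fin n1 → ZMod n2 → ZMod n3 → Fin n4 → ℝ)
      (V : Fin n4 → ZMod n2 → ZMod n3 → Fin n4 → ℝ),
      A = tprod4 U (tprod4 S (ttransp4 V)) ∧
      (∀ (i1 : Fin n1) (i2 : ZMod n2) (i3 : ZMod n3) (i4 : Fin n4),
        i1.val ≠ i4.val → S i1 i2 i3 i4 = 0) ∧
      tprod4 (ttransp4 U) U = tId4 n1 n2 n3 ∧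
      tprod4 (ttransp4 V) V = tId4 n4 n2 n3 := by
  obtain ⟨f, hf⟩ := Function.Involutive.exists_equivariant
    (σ := fun ψ : AddChar (ZMod n2 × ZMod n3) ℂ => ψ⁻¹)
    (τ := fun X : Matrix (Fin n1) (Fin n1) ℂ × Matrix (Fin n1) (Fin n4) ℂ ×
        Matrix (Fin n4) (Fin n4) ℂ =>
      (X.1.map (starRingEnd ℂ), X.2.1.map (starRingEnd ℂ), X.2.2.map (starRingEnd ℂ)))
    (P := fun ψ X => (tdft4 A ψ).IsSVD X)
    inv_inv
    (fun X => by ext <;> simp)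
    (fun ψ X h => by
      rw [tdft4_inv]
      exact h.map (starRingEnd ℂ) fun x => by simp)
    (fun ψ => Matrix.exists_isSVD _)
    (fun ψ hψ => by
      have hreal : tdft4 A ψ = ((tdft4 A ψ).map Complex.re).map Complex.ofRealHom := by
        ext1 i j
        have h := congrFun (congrFun (tdft4_inv A ψ) i) j
        rw [hψ] at h
        exact (Complex.conj_eq_iff_re.mp h.symm).symm
      obtain ⟨X, hX⟩ := Matrix.exists_isSVD ((tdft4 A ψ).map Complex.re)
      have hX' := hX.map Complex.ofRealHom fun x => by simp
      rw [← hreal] at hX'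
      refine ⟨_, hX', ?_⟩
      ext <;> simp)
  have hU : tdft4 (tidft4 fun ψ => (f ψ).1) = fun ψ => (f ψ).1 :=
    tdft4_tidft4 fun ψ => congrArg (fun X => X.1) (hf ψ).2
  have hS : tdft4 (tidft4 fun ψ => (f ψ).2.1) = fun ψ => (f ψ).2.1 :=
    tdft4_tidft4 fun ψ => congrArg (fun X => X.2.1) (hf ψ).2
  have hV : tdft4 (tidft4 fun ψ => (f ψ).2.2) = fun ψ => (f ψ).2.2 :=
    tdft4_tidft4 fun ψ => congrArg (fun X => X.2.2) (hf ψ).2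
  refine ⟨tidft4 fun ψ => (f ψ).1, tidft4 fun ψ => (f ψ).2.1, tidft4 fun ψ => (f ψ).2.2,
    ?_, fun i a b j hij => ?_, ?_, ?_⟩
  · refine tdft4_injective (funext fun ψ => ?_)
    rw [tdft4_tprod4, tdft4_tprod4, tdft4_ttransp4, hU, hS, hV]
    exact (hf ψ).1.eq_mul
  · simp [tidft4, fun ψ => (hf ψ).1.apply_eq_zero i j hij]
  · refine tdft4_injective (funext fun ψ => ?_)
    rw [tdft4_tprod4, tdft4_ttransp4, hU, tdft4_tId4]
    exact (hf ψ).1.left_unitary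
  · refine tdft4_injective (funext fun ψ => ?_)
    rw [tdft4_tprod4, tdft4_ttransp4, hV, tdft4_tId4]
    exact (hf ψ).1.right_unitary
end
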